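/- Correctness of the approximation scheme for decisive STSs: let (S, Σ, κ) be a stochastic transition system that is decisive with respect to B ∈ Σ, and let μ be an initial distribution on S. Then P_μ(F B) + P_μ((S∖B) U B̃) = 1; consequently, for every m ∈ ℕ, P_μ(F^{≤m} B) ≤ P_μ(F B) ≤ 1 − P_μ((S∖B) U^{≤m} B̃), and lim_{m→∞} (P_μ(F^{≤m} B) + P_μ((S∖B) U^{≤m} B̃)) = 1. -/

import Mathlib

open MeasureTheory ProbabilityTheory Filter Set Topology

/-- Prepend one state to an infinite run. -/
def prep {S : Type*} (s : S) (ρ : ℕ → S) : ℕ → S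
  | 0 => s
  | n + 1 => ρ n

/-- Prepend a finite word to an infinite run. -/
def prepList {S : Type*} (l : List S) (ρ : ℕ → S) : ℕ → S := fun n =>
  if h : n < l.length then l.get ⟨n, h⟩ else ρ (n - l.length)

/-- `E` is a tail event: membership is not affected by changing a finite prefix. -/
def IsTailEvent {S : Type*} (E : Set (ℕ → S)) : Prop :=
  ∀ (l : List S) (ρ : ℕ → S), ρ ∈ E ↔ prepList l ρ ∈ E

/-- Cylinder `Cyl A n = {ρ | ρ k ∈ A k for all k < n}` (built from `A 0, …, A (n-1)`). -/
def Cyl {S : Type*} (A : ℕ → Set S) (n : ℕ) : Set (ℕ → S) := {ρ | ∀ k < n, ρ k ∈ A k}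

/-- Event `F B`: eventually reach `B`. -/
def FEv {S : Type*} (B : Set S) : Set (ℕ → S) := {ρ | ∃ n, ρ n ∈ B}

/-- Event `F^{≤ m} B`: reach `B` within `m` steps. -/
def FleEv {S : Type*} (m : ℕ) (B : Set S) : Set (ℕ → S) := {ρ | ∃ n ≤ m, ρ n ∈ B}

/-- Event `G B`: always in `B`. -/
def GEv {S : Type*} (B : Set S) : Set (ℕ → S) := {ρ | ∀ n, ρ n ∈ B}

/-- Event `GF B`: visit `B` infinitely often. -/
def GFEv {S : Type*} (B : Set S) : Set (ℕ → S) := {ρ | ∀ i, ∃ j ≥ i, ρ j ∈ B}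

/-- Event `FG B`: eventually always in `B`. -/
def FGEv {S : Type*} (B : Set S) : Set (ℕ → S) := {ρ | ∃ i, ∀ j ≥ i, ρ j ∈ B}

/-- Event `GF φ_𝒜`: the pattern `A 0, …, A n` occurs at infinitely many positions. -/
def GFPat {S : Type*} (A : ℕ → Set S) (n : ℕ) : Set (ℕ → S) :=
  {ρ | ∀ i, ∃ j ≥ i, ∀ k ≤ n, ρ (j + k) ∈ A k}

/-- Event `A U B`. -/
def UntilEv {S : Type*} (A B : Set S) : Set (ℕ → S) :=
  {ρ | ∃ n, ρ n ∈ B ∧ ∀ k < n, ρ k ∈ A}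

/-- Event `A U^{≤ m} B`. -/
def UntilLeEv {S : Type*} (m : ℕ) (A B : Set S) : Set (ℕ → S) :=
  {ρ | ∃ n ≤ m, ρ n ∈ B ∧ ∀ k < n, ρ k ∈ A}

/-- The filtration `F n`: σ-algebra generated by the cylinders of length `n`,
i.e., by the first `n` coordinates. -/
def cylFiltration (S : Type*) [MeasurableSpace S] (n : ℕ) : MeasurableSpace (ℕ → S) :=
  MeasurableSpace.comap (fun ρ (i : Fin n) => ρ i) inferInstance

/-- `P` is the family of path measures of the STS `(S, Σ, κ)` given by the
Ionescu–Tulcea construction: for every initial probability distribution `μ`,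
`P μ` is a probability measure on runs, and `P` satisfies the Markov property
(`s₀ ∼ μ`, and the rest of the run follows the chain started in `κ s₀`),
which uniquely characterizes the Ionescu–Tulcea path measures. -/
def IsPathMeasure {S : Type*} [MeasurableSpace S] (κ : Kernel S S)
    (P : Measure S → Measure (ℕ → S)) : Prop :=
  (∀ μ : Measure S, IsProbabilityMeasure μ → IsProbabilityMeasure (P μ)) ∧
  (∀ μ : Measure S, IsProbabilityMeasure μ →
    P μ = μ.bind fun s => (P (κ s)).map (prep s))

/-- `B̃`: the set of states from which `B` is reached with probability zero. -/
def Btilde {S : Type*} [MeasurableSpace S] (P : Measure S → Measure (ℕ → S)) (B : Set S) :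
    Set S := {s | P (Measure.dirac s) (FEv B) = 0}

/-- The STS with path measures `P` is decisive w.r.t. `B`. -/
def Decisive {S : Type*} [MeasurableSpace S] (P : Measure S → Measure (ℕ → S)) (B : Set S) :
    Prop := ∀ μ : Measure S, IsProbabilityMeasure μ → P μ (FEv B ∪ FEv (Btilde P B)) = 1

/-- `ν_{A₀,…,Aₙ}`: the distribution of the `n`-th state under `P ν` conditioned on
the cylinder `Cyl A (n+1)`. -/
noncomputable def condDist {S : Type*} [MeasurableSpace S]
    (P : Measure S → Measure (ℕ → S)) (ν : Measure S) (A : ℕ → Set S) (n : ℕ) : Measure S :=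
  (ProbabilityTheory.cond (P ν) (Cyl A (n + 1))).map fun ρ => ρ n

theorem measurable_prep {S : Type*} [MeasurableSpace S] (s : S) :
    Measurable (prep s : (ℕ → S) → ℕ → S) := by
  refine measurable_pi_lambda _ fun n => ?_
  cases n with
  | zero => exact measurable_const
  | succ n => exact measurable_pi_apply n

theorem measurableSet_FEv {S : Type*} [MeasurableSpace S] {B : Set S} (hB : MeasurableSet B) :
    MeasurableSet (FEv B) := by
  have : FEv B = ⋃ n, (fun ρ : ℕ → S => ρ n) ⁻¹' B := by
    ext ρ
    simp [FEv]
  rw [this]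
  exact MeasurableSet.iUnion fun n => measurable_pi_apply n hB

/-- An almost everywhere measurable function is pinned at `s` by the Dirac measure at `s`,
even when `{s}` is not measurable. -/
theorem bind_dirac_of_aemeasurable {α β : Type*} [MeasurableSpace α] [MeasurableSpace β]
    {f : α → Measure β} {a : α} (hf : AEMeasurable f (Measure.dirac a)) :
    (Measure.dirac a).bind f = f a := by
  have ha : f a = hf.mk f a := by
    by_contra hne
    have h0 : Measure.dirac a {x | f x ≠ hf.mk f x} = 0 := hf.ae_eq_mk
    have h1 : (1 : ENNReal) ≤ Measure.dirac a {x | f x ≠ hf.mk f x} := by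
      refine le_trans (le_of_eq ?_) Measure.le_dirac_apply
      exact (indicator_of_mem (s := {x | f x ≠ hf.mk f x}) hne (1 : α → ENNReal)).symm
    simp [h0] at h1
  have hmk : (Measure.dirac a).bind f = (Measure.dirac a).bind (hf.mk f) :=
    Measure.bind_congr_right hf.ae_eq_mk
  rw [hmk, Measure.dirac_bind hf.measurable_mk, ha]

namespace IsPathMeasure

variable {S : Type*} [MeasurableSpace S] {κ : Kernel S S} {P : Measure S → Measure (ℕ → S)}

/-- The junk value of `Measure.bind` rules out the non-measurable case. -/
theorem aemeasurable_map_prep (hP : IsPathMeasure κ P) (μ : Measure S)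
    [IsProbabilityMeasure μ] : AEMeasurable (fun s => (P (κ s)).map (prep s)) μ := by
  by_contra h
  have := hP.1 μ ‹_›
  refine IsProbabilityMeasure.ne_zero (P μ) ?_
  rw [hP.2 μ ‹_›, Measure.bind, Measure.map_of_not_aemeasurable h, Measure.join_zero]

theorem apply_dirac (hP : IsPathMeasure κ P) (s : S) :
    P (Measure.dirac s) = (P (κ s)).map (prep s) := by
  rw [hP.2 _ inferInstance]
  exact bind_dirac_of_aemeasurable (hP.aemeasurable_map_prep _)

theorem nullMeasurableSet_Btilde (hP : IsPathMeasure κ P) {B : Set S} (hB : MeasurableSet B)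
    (μ : Measure S) [IsProbabilityMeasure μ] : NullMeasurableSet (Btilde P B) μ := by
  have h : AEMeasurable (fun s => P (Measure.dirac s) (FEv B)) μ := by
    simp_rw [hP.apply_dirac]
    exact (Measure.measurable_coe (measurableSet_FEv hB)).comp_aemeasurable
      (hP.aemeasurable_map_prep μ)
  exact h.nullMeasurable (measurableSet_singleton 0)

theorem nullMeasurableSet_visit (hP : IsPathMeasure κ P) {B : Set S} (hB : MeasurableSet B)
    (n : ℕ) (μ : Measure S) [IsProbabilityMeasure μ] :
    NullMeasurableSet {ρ | ρ n ∈ Btilde P B ∧ ∃ m, ρ (n + m) ∈ B} (P μ) := by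
  have := hP.1 μ ‹_›
  have hn : Measurable fun ρ : ℕ → S => ρ n := measurable_pi_apply n
  have : IsProbabilityMeasure ((P μ).map fun ρ => ρ n) :=
    Measure.isProbabilityMeasure_map hn.aemeasurable
  refine NullMeasurableSet.inter ((hP.nullMeasurableSet_Btilde hB _).preimage
    (hn.quasiMeasurePreserving _)) (MeasurableSet.nullMeasurableSet ?_)
  have hshift : Measurable fun (ρ : ℕ → S) m => ρ (n + m) :=
    measurable_pi_lambda _ fun m => measurable_pi_apply (n + m)
  exact hshift (measurableSet_FEv hB)

theorem measure_eq_zero_of_preimage_prep (hP : IsPathMeasure κ P) (μ : Measure S)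
    [IsProbabilityMeasure μ] {E : Set (ℕ → S)} (hE : NullMeasurableSet E (P μ))
    (h : ∀ s, P (κ s) (prep s ⁻¹' E) = 0) : P μ E = 0 := by
  obtain ⟨T, hTE, hT, hae⟩ := hE.exists_measurable_subset_ae_eq
  rw [← measure_congr hae, hP.2 μ ‹_›, Measure.bind_apply hT (hP.aemeasurable_map_prep μ)]
  refine lintegral_eq_zero_of_ae_eq_zero (Eventually.of_forall fun s => ?_)
  change (P (κ s)).map (prep s) T = 0
  rw [Measure.map_apply (measurable_prep s) hT]
  exact measure_mono_null (preimage_mono hTE) (h s)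

/-- After a visit to `Btilde P B`, almost surely `B` is never visited. -/
theorem measure_Btilde_then_reach (hP : IsPathMeasure κ P) [IsMarkovKernel κ] {B : Set S}
    (hB : MeasurableSet B) (n : ℕ) (μ : Measure S) [IsProbabilityMeasure μ] :
    P μ {ρ | ρ n ∈ Btilde P B ∧ ∃ m, ρ (n + m) ∈ B} = 0 := by
  induction n generalizing μ with
  | zero =>
    refine hP.measure_eq_zero_of_preimage_prep μ (hP.nullMeasurableSet_visit hB 0 μ) fun s => ?_
    by_cases hs : s ∈ Btilde P B
    · have h0 : P (Measure.dirac s) (FEv B) = 0 := hs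
      rw [hP.apply_dirac, Measure.map_apply (measurable_prep s) (measurableSet_FEv hB)] at h0
      refine measure_mono_null (fun ρ hρ => ?_) h0
      obtain ⟨-, m, hm⟩ := hρ
      exact ⟨m, by simpa using hm⟩
    · convert measure_empty (μ := P (κ s))
      exact eq_empty_of_forall_notMem fun ρ hρ => hs hρ.1
  | succ n ih =>
    refine hP.measure_eq_zero_of_preimage_prep μ (hP.nullMeasurableSet_visit hB _ μ) fun s => ?_
    convert ih (κ s) using 2
    ext ρ
    simp [prep, Nat.add_right_comm n 1]

end IsPathMeasure

/-- **Correctness of the approximation scheme for decisive STSs.** If the STS is decisive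
w.r.t. `B`, then `P_μ(F B) + P_μ((S∖B) U B̃) = 1`; consequently, for every `m`,
`P_μ(F^{≤m} B) ≤ P_μ(F B) ≤ 1 − P_μ((S∖B) U^{≤m} B̃)`, and
`P_μ(F^{≤m} B) + P_μ((S∖B) U^{≤m} B̃) → 1` as `m → ∞`. -/
theorem approximation_scheme_correct
    {S : Type*} [MeasurableSpace S] (κ : Kernel S S) [IsMarkovKernel κ]
    (P : Measure S → Measure (ℕ → S)) (hP : IsPathMeasure κ P)
    (B : Set S) (hB : MeasurableSet B)
    (hdec : Decisive P B)
    (μ : Measure S) (hμ : IsProbabilityMeasure μ) :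
    P μ (FEv B) + P μ (UntilEv Bᶜ (Btilde P B)) = 1 ∧
    (∀ m : ℕ,
      P μ (FleEv m B) ≤ P μ (FEv B) ∧
      P μ (FEv B) ≤ 1 - P μ (UntilLeEv m Bᶜ (Btilde P B))) ∧
    Tendsto (fun m => P μ (FleEv m B) + P μ (UntilLeEv m Bᶜ (Btilde P B)))
      atTop (𝓝 1) := by
  have := hP.1 μ hμ
  have hinter : P μ (FEv B ∩ UntilEv Bᶜ (Btilde P B)) = 0 := by
    refine measure_mono_null ?_
      (measure_iUnion_null fun n => hP.measure_Btilde_then_reach hB n μ)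
    rintro ρ ⟨⟨m, hm⟩, n, hn, hlt⟩
    have hnm : n ≤ m := not_lt.1 fun h => hlt m h hm
    exact mem_iUnion.2 ⟨n, hn, m - n, by rwa [Nat.add_sub_cancel' hnm]⟩
  have hunion : P μ (FEv B ∪ UntilEv Bᶜ (Btilde P B)) = 1 := by
    refine le_antisymm prob_le_one ((hdec μ hμ).symm.le.trans (measure_mono ?_))
    rintro ρ (h | ⟨n, hn⟩)
    · exact Or.inl h
    · by_cases h : ρ ∈ FEv B
      · exact Or.inl h
      · exact Or.inr ⟨n, hn, fun k _ hk => h ⟨k, hk⟩⟩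
  have hsum : P μ (FEv B) + P μ (UntilEv Bᶜ (Btilde P B)) = 1 := by
    rw [← measure_union_add_inter' (measurableSet_FEv hB), hunion, hinter, add_zero]
  refine ⟨hsum, fun m => ⟨measure_mono fun ρ ⟨n, _, hn⟩ => ⟨n, hn⟩, ?_⟩, ?_⟩
  · refine ENNReal.le_sub_of_add_le_right (measure_ne_top _ _) (hsum.le.trans' ?_)
    gcongr
    exact fun ρ ⟨n, _, hn⟩ => ⟨n, hn⟩
  · have hF : FEv B = ⋃ m, FleEv m B := by
      ext ρ
      simp only [FEv, FleEv, mem_ofPred_eq, mem_iUnion]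
      exact ⟨fun ⟨n, hn⟩ => ⟨n, n, le_rfl, hn⟩, fun ⟨_, n, _, hn⟩ => ⟨n, hn⟩⟩
    have hU : UntilEv Bᶜ (Btilde P B) = ⋃ m, UntilLeEv m Bᶜ (Btilde P B) := by
      ext ρ
      simp only [UntilEv, UntilLeEv, mem_ofPred_eq, mem_iUnion]
      exact ⟨fun ⟨n, hn⟩ => ⟨n, n, le_rfl, hn⟩, fun ⟨_, n, _, hn⟩ => ⟨n, hn⟩⟩
    rw [← hsum, hF, hU]
    have hFmono : Monotone fun m => FleEv m B :=
      fun _ _ hab _ ⟨n, hn, h⟩ => ⟨n, hn.trans hab, h⟩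
    have hUmono : Monotone fun m => UntilLeEv m Bᶜ (Btilde P B) :=
      fun _ _ hab _ ⟨n, hn, h⟩ => ⟨n, hn.trans hab, h⟩
    exact (tendsto_measure_iUnion_atTop hFmono).add (tendsto_measure_iUnion_atTop hUmono)
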